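/- If the canonical command sets A₁, …, A_k are pairwise refluent, then they are jointly refluent: there is a single filesystem that none of them breaks. -/

import Mathlib

namespace FileSync

/-- A filesystem value: a directory, the empty value, or a file with content from `C`. -/
inductive Val (C : Type) : Type where
  | dir : Val C
  | empty : Val C
  | file : C → Val C

/-- The type of a value, ordered E < F < D via 0 < 1 < 2. -/
def vtype {C : Type} : Val C → ℕ
  | Val.empty => 0
  | Val.file _ => 1
  | Val.dir => 2

/-- A node is a nonempty finite sequence of names. -/
abbrev Node (N : Type) : Type := { l : List N // l ≠ ([] : List N) }

/-- `Anc m n`: `m` is a proper ancestor of (strictly above) `n`. -/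
def Anc {N : Type} (m n : Node N) : Prop := m.1 <+: n.1 ∧ m ≠ n

/-- Two nodes are comparable if one is a prefix of the other. -/
def NodesComparable {N : Type} (m n : Node N) : Prop := m.1 <+: n.1 ∨ n.1 <+: m.1

/-- `IsParent p n`: `p` is the parent of `n` (removing the last name of `n` gives `p`). -/
def IsParent {N : Type} (p n : Node N) : Prop := ∃ a : N, n.1 = p.1 ++ [a]

/-- A command: a node, an input value (precondition) and an output value. -/
structure Cmd (N C : Type) where
  node : Node N
  inp : Val C
  out : Val C

variable {N C : Type} [DecidableEq N]

/-- A valid filesystem: finitely many non-empty nodes, and the tree property. -/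
def ValidFS (f : Node N → Val C) : Prop :=
  {n : Node N | f n ≠ Val.empty}.Finite ∧
  ∀ n m : Node N, Anc m n → f n ≠ Val.empty → f m = Val.dir

/-- Replace the value at the node of `σ` by its output value. -/
def upd (f : Node N → Val C) (σ : Cmd N C) : Node N → Val C :=
  fun m => if m = σ.node then σ.out else f m

/-- `SeqOK α f`: the command sequence `α` does not break the filesystem `f`:
each command finds its input value and yields a valid filesystem. -/
def SeqOK : List (Cmd N C) → (Node N → Val C) → Prop
  | [], _ => True
  | σ :: rest, f => f σ.node = σ.inp ∧ ValidFS (upd f σ) ∧ SeqOK rest (upd f σ)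

/-- The result of applying a command sequence (left to right). -/
def applySeq : List (Cmd N C) → (Node N → Val C) → (Node N → Val C)
  | [], f => f
  | σ :: rest, f => applySeq rest (upd f σ)

/-- A sequence is non-breaking if there is at least one filesystem it does not break. -/
def NonBreaking (α : List (Cmd N C)) : Prop := ∃ f, ValidFS f ∧ SeqOK α f

/-- Semantic equivalence: on every filesystem both break, or both yield the same result. -/
def SeqEquiv (α β : List (Cmd N C)) : Prop :=
  ∀ f, ValidFS f → ((SeqOK α f ↔ SeqOK β f) ∧ (SeqOK α f → applySeq α f = applySeq β f))

/-- `SeqExt α β`: `β` semantically extends `α` (`α ≤ β`). -/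
def SeqExt (α β : List (Cmd N C)) : Prop :=
  ∀ f, ValidFS f → SeqOK α f → SeqOK β f ∧ applySeq β f = applySeq α f

/-- The `≪` relation between commands on child–parent or parent–child nodes. -/
def LL (σ τ : Cmd N C) : Prop :=
  (IsParent τ.node σ.node ∧ σ.out = Val.empty ∧ σ.inp ≠ Val.empty ∧
      τ.inp = Val.dir ∧ τ.out ≠ Val.dir) ∨
  (IsParent σ.node τ.node ∧ σ.out = Val.dir ∧ σ.inp ≠ Val.dir ∧
      τ.inp = Val.empty ∧ τ.out ≠ Val.empty)

/-- A canonical command set: finite, no null commands, at most one command per node,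
`≪`-connected (commands on distinct comparable nodes are joined by a `≪`-chain in the set). -/
def Canonical (A : Set (Cmd N C)) : Prop :=
  A.Finite ∧
  (∀ σ ∈ A, σ.inp ≠ σ.out) ∧
  (∀ σ ∈ A, ∀ τ ∈ A, σ.node = τ.node → σ = τ) ∧
  (∀ σ ∈ A, ∀ τ ∈ A, σ.node ≠ τ.node → NodesComparable σ.node τ.node →
    Relation.ReflTransGen (fun a b => a ∈ A ∧ b ∈ A ∧ LL a b) σ τ ∨
    Relation.ReflTransGen (fun a b => a ∈ A ∧ b ∈ A ∧ LL a b) τ σ)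

/-- A sequence honors `≪`: whenever `σ ≪ τ` for members, `σ` precedes `τ`. -/
def Honors (α : List (Cmd N C)) : Prop :=
  ∀ σ ∈ α, ∀ τ ∈ α, LL σ τ → List.Sublist [σ, τ] α

/-- A canonical sequence: its commands form a canonical set and it honors `≪`. -/
def CanonicalSeq (α : List (Cmd N C)) : Prop :=
  α.Nodup ∧ Canonical {σ : Cmd N C | σ ∈ α} ∧ Honors α

/-- `Orders A α`: the sequence `α` is an arrangement of the set `A` honoring `≪`. -/
def Orders (A : Set (Cmd N C)) (α : List (Cmd N C)) : Prop :=
  α.Nodup ∧ (∀ σ : Cmd N C, σ ∈ α ↔ σ ∈ A) ∧ Honors α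

/-- The action of a canonical set: `A` does not break `f`
(some `≪`-honoring arrangement exists, and every such arrangement works on `f`). -/
def SetNoBreak (A : Set (Cmd N C)) (f : Node N → Val C) : Prop :=
  (∃ α, Orders A α) ∧ ∀ α, Orders A α → SeqOK α f

/-- `SetApp A f g`: applying the set `A` (in any `≪`-honoring order) to `f` yields `g`. -/
def SetApp (A : Set (Cmd N C)) (f g : Node N → Val C) : Prop :=
  SetNoBreak A f ∧ ∀ α, Orders A α → applySeq α f = g

/-- The set `S` has a command on node `n`. -/
def Mentions (S : Set (Cmd N C)) (n : Node N) : Prop := ∃ ρ ∈ S, ρ.node = n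

/-- Two canonical sets are refluent if some filesystem is broken by neither. -/
def Refluent (A B : Set (Cmd N C)) : Prop :=
  ∃ f, ValidFS f ∧ SetNoBreak A f ∧ SetNoBreak B f

/-- Canonical sets are jointly refluent if a single filesystem is broken by none of them. -/
def JointlyRefluent {k : ℕ} (A : Fin k → Set (Cmd N C)) : Prop :=
  ∃ f, ValidFS f ∧ ∀ i, SetNoBreak (A i) f

/-- Two distinct commands are in conflict if they are on the same node, or one is on a
proper ancestor node, creates a non-directory, and the lower one creates non-empty content. -/
def Conflict (σ τ : Cmd N C) : Prop :=
  σ ≠ τ ∧ (σ.node = τ.node ∨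
    (Anc σ.node τ.node ∧ σ.out ≠ Val.dir ∧ τ.out ≠ Val.empty) ∨
    (Anc τ.node σ.node ∧ τ.out ≠ Val.dir ∧ σ.out ≠ Val.empty))

/-- A merger: a maximal canonical subset of `⋃ i, A i`. -/
def Merger {k : ℕ} (A : Fin k → Set (Cmd N C)) (M : Set (Cmd N C)) : Prop :=
  M ⊆ (⋃ i, A i) ∧ Canonical M ∧
  ∀ M' : Set (Cmd N C), M ⊆ M' → M' ⊆ (⋃ i, A i) → Canonical M' → M' = M

/-- `B` is an initial segment of `A`: there is an `≪`-honoring arrangement of `A` in which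
all commands of `B` precede all commands of `A \ B`. -/
def InitSeg (B A : Set (Cmd N C)) : Prop :=
  B ⊆ A ∧ ∃ α₁ α₂ : List (Cmd N C), Orders B α₁ ∧ Orders (A \ B) α₂ ∧ Orders A (α₁ ++ α₂)

/-- The inverse of a command. -/
def cinv (σ : Cmd N C) : Cmd N C := ⟨σ.node, σ.out, σ.inp⟩

/-- The inverse of a sequence: inverses of its commands in reverse order. -/
def seqInv (α : List (Cmd N C)) : List (Cmd N C) := (α.map cinv).reverse

open Classical in
/-- Pointwise action of a command set. -/
noncomputable def app (A : Set (Cmd N C)) (f : Node N → Val C) : Node N → Val C :=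
  fun n => if h : ∃ σ ∈ A, σ.node = n then h.choose.out else f n

def NodeInj (A : Set (Cmd N C)) : Prop := ∀ σ ∈ A, ∀ τ ∈ A, σ.node = τ.node → σ = τ

theorem app_mem {A : Set (Cmd N C)} (hA : NodeInj A) (f : Node N → Val C) {σ : Cmd N C}
    (h : σ ∈ A) : app A f σ.node = σ.out := by
  have h' : ∃ τ ∈ A, τ.node = σ.node := ⟨σ, h, rfl⟩
  unfold app
  rw [dif_pos h']
  rw [hA _ h'.choose_spec.1 _ h h'.choose_spec.2]

theorem app_not {A : Set (Cmd N C)} (f : Node N → Val C) {n : Node N}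
    (h : ¬ Mentions A n) : app A f n = f n := by
  unfold app
  exact dif_neg h

theorem applySeq_eq (α : List (Cmd N C)) (f : Node N → Val C)
    (hp : α.Pairwise (fun a b => a.node ≠ b.node)) :
    applySeq α f = app {σ | σ ∈ α} f := by
  induction α generalizing f with
  | nil => funext n; rw [app_not]; rfl; rintro ⟨ρ, hρ, _⟩; simp at hρ
  | cons σ rest ih =>
    rw [List.pairwise_cons] at hp
    have inj : ∀ l : List (Cmd N C), l.Pairwise (fun a b => a.node ≠ b.node) →
        NodeInj {σ | σ ∈ l} := by
      intro l hl a ha b hb hab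
      by_contra hne
      haveI : Std.Symm (fun a b : Cmd N C => a.node ≠ b.node) := ⟨fun _ _ h => Ne.symm h⟩
      exact hl.forall ha hb hne hab
    have i1 := inj rest hp.2
    have i2 := inj (σ :: rest) (List.pairwise_cons.2 hp)
    show applySeq rest (upd f σ) = _
    rw [ih _ hp.2]
    funext n
    by_cases h1 : Mentions {σ | σ ∈ rest} n
    · obtain ⟨τ, hτ, rfl⟩ := h1
      rw [app_mem i1 _ hτ, app_mem i2 _ (List.mem_cons_of_mem _ hτ)]
    · rw [app_not _ h1]
      by_cases h2 : n = σ.node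
      · subst h2
        rw [app_mem i2 _ (List.mem_cons_self)]
        simp [upd]
      · rw [app_not]
        · simp [upd, h2]
        · rintro ⟨τ, hτ, rfl⟩
          rcases List.mem_cons.1 hτ with rfl | h
          · exact h2 rfl
          · exact h1 ⟨τ, h, rfl⟩

theorem seqOK_of (α : List (Cmd N C)) (f : Node N → Val C)
    (hp : α.Pairwise (fun a b => a.node ≠ b.node))
    (hm : ∀ σ ∈ α, f σ.node = σ.inp)
    (hv : ∀ β γ, α = β ++ γ → ValidFS (applySeq β f)) : SeqOK α f := by
  induction α generalizing f with
  | nil => trivial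
  | cons σ rest ih =>
    rw [List.pairwise_cons] at hp
    refine ⟨hm σ List.mem_cons_self, hv [σ] rest rfl, ih _ hp.2 ?_ ?_⟩
    · intro τ hτ
      rw [← hm τ (List.mem_cons_of_mem _ hτ)]
      simp [upd, (hp.1 τ hτ).symm]
    · intro β γ h
      exact hv (σ :: β) γ (by rw [h]; rfl)

theorem of_seqOK (α : List (Cmd N C)) (f : Node N → Val C)
    (hp : α.Pairwise (fun a b => a.node ≠ b.node)) (hf : ValidFS f) (h : SeqOK α f) :
    (∀ σ ∈ α, f σ.node = σ.inp) ∧ ValidFS (applySeq α f) := by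
  induction α generalizing f with
  | nil => exact ⟨by simp, hf⟩
  | cons σ rest ih =>
    rw [List.pairwise_cons] at hp
    obtain ⟨h1, h2, h3⟩ := h
    obtain ⟨h4, h5⟩ := ih _ hp.2 h2 h3
    refine ⟨?_, h5⟩
    intro τ hτ
    rcases List.mem_cons.1 hτ with rfl | hτ
    · exact h1
    · rw [← h4 τ hτ]
      simp [upd, (hp.1 τ hτ).symm]

def Good (A : Set (Cmd N C)) (f : Node N → Val C) : Prop :=
  ValidFS f ∧ (∀ σ ∈ A, f σ.node = σ.inp) ∧ ValidFS (app A f)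

theorem orders_pairwise {A : Set (Cmd N C)} (hA : NodeInj A) {α : List (Cmd N C)}
    (h : Orders A α) : α.Pairwise (fun a b => a.node ≠ b.node) := by
  refine List.Pairwise.imp_of_mem ?_ h.1
  intro a b ha hb hab he
  exact hab (hA _ ((h.2.1 a).1 ha) _ ((h.2.1 b).1 hb) he)

theorem orders_set {A : Set (Cmd N C)} {α : List (Cmd N C)}
    (h : Orders A α) : {σ | σ ∈ α} = A := by
  ext σ; exact h.2.1 σ

theorem good_of_noBreak {A : Set (Cmd N C)} (hA : NodeInj A) {f : Node N → Val C}
    (hf : ValidFS f) (h : SetNoBreak A f) : Good A f := by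
  obtain ⟨⟨α, hα⟩, h⟩ := h
  have hp := orders_pairwise hA hα
  obtain ⟨h1, h2⟩ := of_seqOK α f hp hf (h α hα)
  rw [applySeq_eq α f hp, orders_set hα] at h2
  exact ⟨hf, fun σ hσ => h1 σ ((hα.2.1 σ).2 hσ), h2⟩

def Step (A : Set (Cmd N C)) (a b : Cmd N C) : Prop := a ∈ A ∧ b ∈ A ∧ LL a b

theorem parent_anc {p n : Node N} (h : IsParent p n) : Anc p n := by
  obtain ⟨a, ha⟩ := h
  refine ⟨⟨[a], ha.symm⟩, ?_⟩
  rintro rfl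
  have := congrArg List.length ha
  simp at this

theorem anc_trans {a b c : Node N} (h : Anc a b) (h' : Anc b c) : Anc a c := by
  refine ⟨h.1.trans h'.1, ?_⟩
  rintro rfl
  exact h.2 (Subtype.ext (h.1.eq_of_length (le_antisymm h.1.length_le h'.1.length_le)))

theorem anc_asymm {a b : Node N} (h : Anc a b) (h' : Anc b a) : False :=
  (anc_trans h h').2 rfl

/-- A node between a parent and its child is one of the two. -/
theorem between_parent {p c n : Node N} (h : IsParent p c) (h1 : p.1 <+: n.1)
    (h2 : n.1 <+: c.1) : n = p ∨ n = c := by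
  obtain ⟨a, ha⟩ := h
  rw [ha, List.prefix_concat_iff] at h2
  rcases h2 with h2 | h2
  · right; exact Subtype.ext (by rw [h2, ha])
  · left
    exact Subtype.ext (h2.eq_of_length (le_antisymm h2.length_le h1.length_le))

theorem chain_cases {A : Set (Cmd N C)} {a b : Cmd N C} (ha : a ∈ A)
    (h : Relation.ReflTransGen (Step A) a b) :
    a = b ∨
    (Anc b.node a.node ∧ a.out = Val.empty ∧ b.inp = Val.dir ∧ b.out ≠ Val.dir ∧
      ∀ n : Node N, b.node.1 <+: n.1 → n.1 <+: a.node.1 → Mentions A n) ∨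
    (Anc a.node b.node ∧ a.out = Val.dir ∧ b.inp = Val.empty ∧ b.out ≠ Val.empty ∧
      ∀ n : Node N, a.node.1 <+: n.1 → n.1 <+: b.node.1 → Mentions A n) := by
  induction h with
  | refl => left; rfl
  | @tail b c hab hbc ih =>
    obtain ⟨hb, hc, hl⟩ := hbc
    right
    rcases ih with rfl | ⟨i1, i2, i3, i4, i5⟩ | ⟨i1, i2, i3, i4, i5⟩
    · rcases hl with ⟨l1, l2, l3, l4, l5⟩ | ⟨l1, l2, l3, l4, l5⟩
      · left
        refine ⟨parent_anc l1, l2, l4, l5, ?_⟩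
        intro n h1 h2
        rcases between_parent l1 h1 h2 with rfl | rfl
        · exact ⟨_, hc, rfl⟩
        · exact ⟨_, hb, rfl⟩
      · right
        refine ⟨parent_anc l1, l2, l4, l5, ?_⟩
        intro n h1 h2
        rcases between_parent l1 h1 h2 with rfl | rfl
        · exact ⟨_, hb, rfl⟩
        · exact ⟨_, hc, rfl⟩
    · rcases hl with ⟨l1, l2, l3, l4, l5⟩ | ⟨l1, l2, l3, l4, l5⟩
      · left
        refine ⟨anc_trans (parent_anc l1) i1, i2, l4, l5, ?_⟩
        intro n h1 h2
        rcases List.prefix_or_prefix_of_prefix h2 i1.1 with h3 | h3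
        · rcases between_parent l1 h1 h3 with rfl | rfl
          · exact ⟨_, hc, rfl⟩
          · exact ⟨_, hb, rfl⟩
        · exact i5 n h3 h2
      · exact absurd l2 i4
    · rcases hl with ⟨l1, l2, l3, l4, l5⟩ | ⟨l1, l2, l3, l4, l5⟩
      · exact absurd l2 i4
      · right
        refine ⟨anc_trans i1 (parent_anc l1), i2, l4, l5, ?_⟩
        intro n h1 h2
        rcases List.prefix_or_prefix_of_prefix h2 (parent_anc l1).1 with h3 | h3
        · exact i5 n h1 h3
        · rcases between_parent l1 h3 h2 with rfl | rfl
          · exact ⟨_, hb, rfl⟩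
          · exact ⟨_, hc, rfl⟩

/-- Two commands of a canonical set on nested nodes: `σ` above `τ`. -/
theorem canon_cases {A : Set (Cmd N C)} (hA : Canonical A) {σ τ : Cmd N C} (hσ : σ ∈ A)
    (hτ : τ ∈ A) (h : Anc σ.node τ.node) :
    (∀ n : Node N, σ.node.1 <+: n.1 → n.1 <+: τ.node.1 → Mentions A n) ∧
    ((Relation.ReflTransGen (Step A) τ σ ∧ τ.out = Val.empty ∧ σ.inp = Val.dir ∧
        σ.out ≠ Val.dir) ∨
     (Relation.ReflTransGen (Step A) σ τ ∧ σ.out = Val.dir ∧ τ.inp = Val.empty ∧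
        τ.out ≠ Val.empty)) := by
  rcases hA.2.2.2 σ hσ τ hτ h.2 (Or.inl h.1) with hc | hc
  · rcases chain_cases hσ hc with rfl | ⟨i1, _⟩ | ⟨i1, i2, i3, i4, i5⟩
    · exact absurd rfl h.2
    · exact (anc_asymm h i1).elim
    · exact ⟨i5, Or.inr ⟨hc, i2, i3, i4⟩⟩
  · rcases chain_cases hτ hc with rfl | ⟨i1, i2, i3, i4, i5⟩ | ⟨i1, _⟩
    · exact absurd rfl h.2
    · exact ⟨i5, Or.inl ⟨hc, i2, i3, i4⟩⟩
    · exact (anc_asymm h i1).elim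

theorem exists_orders {A : Set (Cmd N C)} (hA : A.Finite) : ∃ α, Orders A α := by
  classical
  let key : Cmd N C → ℤ := fun σ =>
    if vtype σ.inp < vtype σ.out then (σ.node.1.length : ℤ) else -(σ.node.1.length : ℤ)
  have hkey : ∀ σ τ : Cmd N C, LL σ τ → key σ < key τ := by
    intro σ τ h
    rcases h with ⟨⟨a, l1⟩, l2, l3, l4, l5⟩ | ⟨⟨a, l1⟩, l2, l3, l4, l5⟩
    · have h1 : ¬ vtype σ.inp < vtype σ.out := by rw [l2]; simp [vtype]
      have h2 : ¬ vtype τ.inp < vtype τ.out := by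
        rw [l4]; cases τ.out <;> simp [vtype]
      simp only [key, h1, h2, if_false, l1]
      simp
    · have h1 : vtype σ.inp < vtype σ.out := by
        rw [l2]; revert l3; cases σ.inp <;> simp [vtype]
      have h2 : vtype τ.inp < vtype τ.out := by
        rw [l4]; revert l5; cases τ.out <;> simp [vtype]
      simp only [key, h1, h2, if_true, l1]
      simp
  let α := hA.toFinset.toList.mergeSort (fun a b => decide (key a ≤ key b))
  have hperm : α.Perm hA.toFinset.toList := List.mergeSort_perm _ _
  have hs : α.Pairwise (fun a b => key a ≤ key b) := by
    have := List.pairwise_mergeSort (le := fun a b => decide (key a ≤ key b))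
      (by intro a b c h1 h2; simp at *; omega)
      (by intro a b; simp; omega) hA.toFinset.toList
    simpa using this
  have hmem : ∀ σ, σ ∈ α ↔ σ ∈ A := by
    intro σ; rw [hperm.mem_iff]; simp
  refine ⟨α, hperm.nodup_iff.2 (Finset.nodup_toList _), hmem, ?_⟩
  intro σ hσ τ hτ hl
  have hlt := hkey _ _ hl
  obtain ⟨s, t, hst⟩ := List.append_of_mem hσ
  rw [hst] at hτ hs ⊢
  rcases List.mem_append.1 hτ with h | h
  · have := (List.pairwise_append.1 hs).2.2 τ h σ List.mem_cons_self
    omega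
  · rcases List.mem_cons.1 h with rfl | h
    · omega
    · exact List.Sublist.trans (List.Sublist.cons_cons _ (List.singleton_sublist.2 h))
        (List.sublist_append_right _ _)

theorem finite_app {A : Set (Cmd N C)} (hA : A.Finite) {f : Node N → Val C}
    (hf : {n : Node N | f n ≠ Val.empty}.Finite) :
    {n : Node N | app A f n ≠ Val.empty}.Finite := by
  refine (hf.union (hA.image Cmd.node)).subset ?_
  intro n hn
  by_cases h : Mentions A n
  · obtain ⟨σ, hσ, rfl⟩ := h
    exact Or.inr ⟨σ, hσ, rfl⟩
  · left
    have : app A f n ≠ Val.empty := hn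
    rwa [app_not _ h] at this

theorem noBreak_of_good {A : Set (Cmd N C)} (hA : Canonical A) {f : Node N → Val C}
    (h : Good A f) : SetNoBreak A f := by
  have inj : NodeInj A := hA.2.2.1
  obtain ⟨hf, hm, hg⟩ := h
  refine ⟨exists_orders hA.1, ?_⟩
  intro α hα
  have hp := orders_pairwise inj hα
  refine seqOK_of α f hp (fun σ hσ => hm σ ((hα.2.1 σ).1 hσ)) ?_
  rintro β γ rfl
  have hpβ := (List.pairwise_append.1 hp).1
  rw [applySeq_eq β f hpβ]
  have hsub : ∀ σ ∈ β, σ ∈ A := fun σ hσ => (hα.2.1 σ).1 (List.mem_append_left _ hσ)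
  have injβ : NodeInj {σ | σ ∈ β} := fun a ha b hb => inj a (hsub a ha) b (hsub b hb)
  have hstep : ∀ a b, Step A a b → b ∈ β → a ∈ β := by
    intro a b ⟨ha, hb, hl⟩ hbβ
    have hs := hα.2.2 a ((hα.2.1 a).2 ha) b ((hα.2.1 b).2 hb) hl
    obtain ⟨l1, l2, he, h1, h2⟩ := List.sublist_append_iff.1 hs
    match l1, he with
    | [], he =>
      have hbγ : b ∈ γ := h2.subset (by rw [List.nil_append] at he; rw [← he]; simp)
      exact absurd rfl ((List.pairwise_append.1 hp).2.2 b hbβ b hbγ)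
    | x :: l, he =>
      have : a = x := by simpa using (List.cons.inj he).1
      exact h1.subset (by rw [this]; simp)
  have hchain : ∀ a b, Relation.ReflTransGen (Step A) a b → b ∈ β → a ∈ β := by
    intro a b h
    induction h with
    | refl => exact id
    | tail _ h2 ih => exact fun hc => ih (hstep _ _ h2 hc)
  refine ⟨finite_app (hA.1.subset hsub) hf.1, ?_⟩
  intro n m hmn hn
  by_cases hnβ : Mentions {σ | σ ∈ β} n
  · obtain ⟨τ, hτ, rfl⟩ := hnβ
    rw [app_mem injβ _ hτ] at hn
    have hgm : app A f m = Val.dir :=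
      hg.2 _ m hmn (by rw [app_mem inj _ (hsub _ hτ)]; exact hn)
    by_cases hmA : Mentions A m
    · obtain ⟨σ, hσ, rfl⟩ := hmA
      rw [app_mem inj _ hσ] at hgm
      have hσβ : σ ∈ β := by
        rcases (canon_cases hA hσ (hsub _ hτ) hmn).2 with h | h
        · exact absurd h.2.1 hn
        · exact hchain _ _ h.1 hτ
      rw [app_mem injβ _ hσβ, hgm]
    · rw [app_not _ hmA] at hgm
      rw [app_not, hgm]
      rintro ⟨σ, hσ, h⟩
      exact hmA ⟨σ, hsub _ hσ, h⟩
  · rw [app_not _ hnβ] at hn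
    have hfm := hf.2 n m hmn hn
    by_cases hmβ : Mentions {σ | σ ∈ β} m
    · obtain ⟨σ, hσ, rfl⟩ := hmβ
      rw [app_mem injβ _ hσ]
      by_contra hd
      have hgn : app A f n = Val.empty := by
        by_contra hne
        have := hg.2 _ _ hmn hne
        rw [app_mem inj _ (hsub _ hσ)] at this
        exact hd this
      by_cases hnA : Mentions A n
      · obtain ⟨τ, hτ, rfl⟩ := hnA
        rcases (canon_cases hA (hsub _ hσ) hτ hmn).2 with h | h
        · exact hnβ ⟨τ, hchain _ _ h.1 hσ, rfl⟩
        · exact hd h.2.1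
      · rw [app_not _ hnA] at hgn
        exact hn hgn
    · rw [app_not _ hmβ, hfm]

open Classical in
/-- The minimal filesystem attached to a set of commands. -/
noncomputable def minFS (U : Set (Cmd N C)) : Node N → Val C := fun n =>
  if h : ∃ σ ∈ U, σ.node = n then h.choose.inp
  else if ∃ σ ∈ U, Anc n σ.node then Val.dir else Val.empty

theorem minFS_mem {U : Set (Cmd N C)}
    (hU : ∀ σ ∈ U, ∀ τ ∈ U, σ.node = τ.node → σ.inp = τ.inp) {σ : Cmd N C} (h : σ ∈ U) :
    minFS U σ.node = σ.inp := by
  have h' : ∃ τ ∈ U, τ.node = σ.node := ⟨σ, h, rfl⟩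
  unfold minFS
  rw [dif_pos h']
  exact hU _ h'.choose_spec.1 _ h h'.choose_spec.2

theorem minFS_anc {U : Set (Cmd N C)} {n : Node N} (h : ¬ Mentions U n) {σ : Cmd N C}
    (hσ : σ ∈ U) (ha : Anc n σ.node) : minFS U n = Val.dir := by
  unfold minFS
  unfold Mentions at h
  rw [dif_neg h, if_pos ⟨σ, hσ, ha⟩]

theorem minFS_ne {U : Set (Cmd N C)} {n : Node N} (h : ¬ Mentions U n)
    (hne : minFS U n ≠ Val.empty) : ∃ σ ∈ U, Anc n σ.node := by
  by_contra hc
  apply hne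
  unfold minFS
  unfold Mentions at h
  rw [dif_neg h, if_neg hc]

theorem minFS_ne_le {U : Set (Cmd N C)} {n : Node N}
    (hne : minFS U n ≠ Val.empty) : ∃ σ ∈ U, n.1 <+: σ.node.1 := by
  by_cases h : Mentions U n
  · obtain ⟨σ, hσ, rfl⟩ := h
    exact ⟨σ, hσ, List.prefix_refl _⟩
  · obtain ⟨σ, hσ, h⟩ := minFS_ne h hne
    exact ⟨σ, hσ, h.1⟩

theorem anc_of_anc_le {a b c : Node N} (h : Anc a b) (h' : b.1 <+: c.1) : Anc a c := by
  by_cases hbc : b = c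
  · exact hbc ▸ h
  · exact anc_trans h ⟨h', hbc⟩

theorem minFS_finite {U : Set (Cmd N C)} (hU : U.Finite) :
    {n : Node N | minFS U n ≠ Val.empty}.Finite := by
  have : (⋃ σ ∈ U, {l : List N | l <+: σ.node.1}).Finite := by
    refine hU.biUnion ?_
    intro σ _
    refine (List.finite_toSet σ.node.1.inits).subset ?_
    intro l hl
    exact (List.mem_inits _ _).2 hl
  refine Set.Finite.of_finite_image (f := Subtype.val) (this.subset ?_)
    Subtype.val_injective.injOn
  rintro _ ⟨n, hn, rfl⟩
  obtain ⟨σ, hσ, h⟩ := minFS_ne_le hn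
  exact Set.mem_biUnion hσ h

/-- Every canonical set is non-breaking. -/
theorem self_good {A : Set (Cmd N C)} (hA : Canonical A) : Good A (minFS A) := by
  have inj : NodeInj A := hA.2.2.1
  have hU : ∀ σ ∈ A, ∀ τ ∈ A, σ.node = τ.node → σ.inp = τ.inp := by
    intro σ hσ τ hτ h; rw [inj σ hσ τ hτ h]
  have hun : ∀ n : Node N, ¬ Mentions A n → minFS A n ≠ Val.empty →
      ∀ σ ∈ A, Anc σ.node n → False := by
    intro n hn hne σ hσ ha
    obtain ⟨τ, hτ, h⟩ := minFS_ne hn hne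
    exact hn ((canon_cases hA hσ hτ (anc_trans ha h)).1 n ha.1 h.1)
  refine ⟨⟨minFS_finite hA.1, ?_⟩, fun σ hσ => minFS_mem hU hσ,
    finite_app hA.1 (minFS_finite hA.1), ?_⟩
  · intro n m hmn hn
    by_cases hmA : Mentions A m
    · obtain ⟨σ, hσ, rfl⟩ := hmA
      by_cases hnA : Mentions A n
      · obtain ⟨τ, hτ, rfl⟩ := hnA
        rw [minFS_mem hU hτ] at hn
        rw [minFS_mem hU hσ]
        rcases (canon_cases hA hσ hτ hmn).2 with h | h
        · exact h.2.2.1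
        · exact absurd h.2.2.1 hn
      · exact (hun n hnA hn σ hσ hmn).elim
    · obtain ⟨σ, hσ, h⟩ := minFS_ne_le hn
      exact minFS_anc hmA hσ (anc_of_anc_le hmn h)
  · intro n m hmn hn
    by_cases hmA : Mentions A m
    · obtain ⟨σ, hσ, rfl⟩ := hmA
      by_cases hnA : Mentions A n
      · obtain ⟨τ, hτ, rfl⟩ := hnA
        rw [app_mem inj _ hτ] at hn
        rw [app_mem inj _ hσ]
        rcases (canon_cases hA hσ hτ hmn).2 with h | h
        · exact absurd h.2.1 hn
        · exact h.2.1
      · rw [app_not _ hnA] at hn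
        exact (hun n hnA hn σ hσ hmn).elim
    · rw [app_not _ hmA]
      by_cases hnA : Mentions A n
      · obtain ⟨τ, hτ, rfl⟩ := hnA
        exact minFS_anc hmA hτ hmn
      · rw [app_not _ hnA] at hn
        obtain ⟨σ, hσ, h⟩ := minFS_ne_le hn
        exact minFS_anc hmA hσ (anc_of_anc_le hmn h)

theorem joint_good {k : ℕ} (A : Fin k → Set (Cmd N C)) (hc : ∀ i, Canonical (A i))
    (h : ∀ i j, ∃ f, Good (A i) f ∧ Good (A j) f) :
    ∀ i, Good (A i) (minFS (⋃ i, A i)) := by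
  have inj : ∀ i, NodeInj (A i) := fun i => (hc i).2.2.1
  have hU : ∀ σ ∈ ⋃ i, A i, ∀ τ ∈ ⋃ i, A i, σ.node = τ.node → σ.inp = τ.inp := by
    intro σ hσ τ hτ he
    obtain ⟨i, hi⟩ := Set.mem_iUnion.1 hσ
    obtain ⟨j, hj⟩ := Set.mem_iUnion.1 hτ
    obtain ⟨f, f1, f2⟩ := h i j
    rw [← f1.2.1 σ hi, ← f2.2.1 τ hj, he]
  have hfin : (⋃ i, A i).Finite := Set.finite_iUnion fun i => (hc i).1
  have hin : ∀ {i σ}, σ ∈ A i → σ ∈ ⋃ i, A i := fun hσ => Set.mem_iUnion.2 ⟨_, hσ⟩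
  -- a non-empty node is forced non-empty by one of the sets
  have W : ∀ n, minFS (⋃ i, A i) n ≠ Val.empty → ∃ j, ∀ F, Good (A j) F → F n ≠ Val.empty := by
    intro n hn
    by_cases hm : Mentions (⋃ i, A i) n
    · obtain ⟨σ, hσ, rfl⟩ := hm
      obtain ⟨j, hj⟩ := Set.mem_iUnion.1 hσ
      refine ⟨j, fun F hF => ?_⟩
      rw [minFS_mem hU hσ] at hn
      rw [hF.2.1 σ hj]
      exact hn
    · obtain ⟨τ, hτ, ha⟩ := minFS_ne hm hn
      obtain ⟨j, hj⟩ := Set.mem_iUnion.1 hτ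
      refine ⟨j, fun F hF => ?_⟩
      have hnj : ¬ Mentions (A j) n := fun ⟨ρ, hρ, he⟩ => hm ⟨ρ, hin hρ, he⟩
      by_cases hi : τ.inp = Val.empty
      · have ho : τ.out ≠ Val.empty := fun ho => (hc j).2.1 τ hj (by rw [hi, ho])
        have := hF.2.2.2 _ n ha (by rw [app_mem (inj j) _ hj]; exact ho)
        rw [app_not _ hnj] at this
        rw [this]; simp
      · have := hF.1.2 _ n ha (by rw [hF.2.1 τ hj]; exact hi)
        rw [this]; simp
  have hvalid : ValidFS (minFS (⋃ i, A i)) := by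
    refine ⟨minFS_finite hfin, ?_⟩
    intro n m hmn hn
    by_cases hm : Mentions (⋃ i, A i) m
    · obtain ⟨σ, hσ, rfl⟩ := hm
      obtain ⟨i, hi⟩ := Set.mem_iUnion.1 hσ
      obtain ⟨j, hj⟩ := W n hn
      obtain ⟨F, F1, F2⟩ := h i j
      rw [minFS_mem hU hσ, ← F1.2.1 σ hi]
      exact F1.1.2 n _ hmn (hj F F2)
    · obtain ⟨σ, hσ, h⟩ := minFS_ne_le hn
      exact minFS_anc hm hσ (anc_of_anc_le hmn h)
  intro i
  refine ⟨hvalid, fun σ hσ => minFS_mem hU (hin hσ),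
    finite_app (hc i).1 (minFS_finite hfin), ?_⟩
  intro n m hmn hn
  by_cases hni : Mentions (A i) n
  · obtain ⟨τ, hτ, rfl⟩ := hni
    rw [app_mem (inj i) _ hτ] at hn
    by_cases hmi : Mentions (A i) m
    · obtain ⟨σ, hσ, rfl⟩ := hmi
      obtain ⟨F, F1, _⟩ := h i i
      have := F1.2.2.2 _ _ hmn (by rw [app_mem (inj i) _ hτ]; exact hn)
      rw [app_mem (inj i) _ hσ] at this ⊢
      exact this
    · rw [app_not _ hmi]
      by_cases hm : Mentions (⋃ i, A i) m
      · obtain ⟨σ, hσ, rfl⟩ := hm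
        obtain ⟨j, hj⟩ := Set.mem_iUnion.1 hσ
        obtain ⟨F, F1, F2⟩ := h i j
        have := F1.2.2.2 _ _ hmn (by rw [app_mem (inj i) _ hτ]; exact hn)
        rw [app_not _ hmi] at this
        rw [minFS_mem hU hσ, ← F2.2.1 σ hj, this]
      · exact minFS_anc hm (hin hτ) hmn
  · rw [app_not _ hni] at hn
    by_cases hmi : Mentions (A i) m
    · obtain ⟨σ, hσ, rfl⟩ := hmi
      obtain ⟨j, hj⟩ := W n hn
      obtain ⟨F, F1, F2⟩ := h i j
      have := F1.2.2.2 n _ hmn (by rw [app_not _ hni]; exact hj F F2)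
      rw [app_mem (inj i) _ hσ] at this ⊢
      exact this
    · rw [app_not _ hmi]
      exact hvalid.2 n m hmn hn

/-- Pairwise refluent canonical sets are jointly refluent. -/
theorem stmt_7 {N C : Type} [DecidableEq N] {k : ℕ} (A : Fin k → Set (Cmd N C))
    (hc : ∀ i, Canonical (A i))
    (h : ∀ i j, i ≠ j → Refluent (A i) (A j)) :
    JointlyRefluent A := by
  have key := joint_good A hc (by
    intro i j
    by_cases hij : i = j
    · subst hij
      exact ⟨_, self_good (hc i), self_good (hc i)⟩
    · obtain ⟨f, hf, h1, h2⟩ := h i j hij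
      exact ⟨f, good_of_noBreak (hc i).2.2.1 hf h1, good_of_noBreak (hc j).2.2.1 hf h2⟩)
  rcases k with _ | k
  · exact ⟨fun _ => Val.empty, ⟨by simp, fun _ _ _ h => absurd rfl h⟩, fun i => i.elim0⟩
  · exact ⟨_, (key 0).1, fun i => noBreak_of_good (hc i) (key i)⟩

end FileSync
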